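/- (The Dirac–Hestenes equation for classical spinor fields implies the relativistic Hamilton–Jacobi equation.) Let m > 0, e ∈ ℝ, let R ∈ ℝ_{1,3} be a constant rotor (even element with RR̃ = 1), let Π, A ∈ ℝ⁴ be constant covectors, set S(x) = −Σ_μ Π_μ x^μ and ψ(x) = R · e^{S(x)γ21}. If ψ satisfies the Dirac–Hestenes equation Σ_μ γ^μ (∂_μ ψ)(x) γ21 − m ψ(x) γ⁰ + e (Σ_μ A_μ γ^μ) ψ(x) = 0 for all x, then Σ_μ (Π_μ + eA_μ) γ^μ = m R γ⁰ R̃, and consequently the relativistic Hamilton–Jacobi equation holds: Σ_{μ,ν} η^{μν}(Π_μ + eA_μ)(Π_ν + eA_ν) = m². -/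

import Mathlib

noncomputable section
open CliffordAlgebra

/-- The Minkowski quadratic form `Q(x) = x₀² - x₁² - x₂² - x₃²` on `ℝ⁴`. -/
def Qmink : QuadraticForm ℝ (Fin 4 → ℝ) :=
  QuadraticMap.weightedSumSquares ℝ ![(1 : ℝ), -1, -1, -1]

/-- The spacetime algebra `ℝ_{1,3}`. -/
abbrev STA : Type := CliffordAlgebra Qmink

/-- The generating vectors `γ_μ = ι(e_μ)`. -/
def γ (μ : Fin 4) : STA := ι Qmink (Pi.single μ 1)

/-- The signs `η^{μμ} = diag(1,-1,-1,-1)`. -/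
def ηsgn (μ : Fin 4) : ℝ := if μ = 0 then 1 else -1

/-- The raised-index vectors `γ^μ := η^{μμ} γ_μ`. -/
def γup (μ : Fin 4) : STA := ηsgn μ • γ μ

/-- The bivector `γ21 := γ₂γ₁` (it squares to `-1`). -/
def γ21 : STA := γ 2 * γ 1

/-- `e^{θ γ21} := cos θ + (sin θ) γ21`. -/
def expG21 (θ : ℝ) : STA := algebraMap ℝ STA (Real.cos θ) + Real.sin θ • γ21

/-- The partial derivative `∂_μ f` of a function `f : ℝ⁴ → ℝ` at `x`. -/
def pd (μ : Fin 4) (f : (Fin 4 → ℝ) → ℝ) (x : Fin 4 → ℝ) : ℝ :=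
  deriv (fun t : ℝ => f (x + t • (Pi.single μ 1 : Fin 4 → ℝ))) 0

/-- `f' ` is the `μ`-th partial derivative of the spacetime-algebra valued field `f`
(tested against all real-linear functionals, since `STA` carries no topology). -/
def HasPDeriv (μ : Fin 4) (f f' : (Fin 4 → ℝ) → STA) : Prop :=
  ∀ (L : STA →ₗ[ℝ] ℝ) (x : Fin 4 → ℝ),
    HasDerivAt (fun t : ℝ => L (f (x + t • (Pi.single μ 1 : Fin 4 → ℝ)))) (L (f' x)) 0

/-- The Minkowski metric matrix `η^{μν} = diag(1,-1,-1,-1)`. -/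
def ηm (μ ν : Fin 4) : ℝ := if μ = ν then (if μ = 0 then 1 else -1) else 0

theorem Qmink_single (μ : Fin 4) : Qmink (Pi.single μ 1) = ηsgn μ := by
  fin_cases μ <;> simp [Qmink, ηsgn, QuadraticMap.weightedSumSquares_apply, Fin.sum_univ_four]

theorem γ_mul_self (μ : Fin 4) : γ μ * γ μ = algebraMap ℝ STA (ηsgn μ) := by
  rw [γ, ι_sq_scalar, Qmink_single]

theorem γ_one_mul_γ_two : γ 1 * γ 2 = -(γ 2 * γ 1) := by
  refine eq_neg_of_add_eq_zero_left ((ι_mul_ι_add_swap _ _).trans ?_)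
  refine (congrArg _ ?_).trans (map_zero _)
  simp [Qmink, QuadraticMap.polar, QuadraticMap.weightedSumSquares_apply, Fin.sum_univ_four]

theorem γ21_mul_self : γ21 * γ21 = -1 := by
  calc γ21 * γ21 = γ 2 * (γ 1 * γ 2) * γ 1 := by simp only [γ21, mul_assoc]
    _ = -(γ 2 * γ 2 * (γ 1 * γ 1)) := by
      rw [γ_one_mul_γ_two]; simp only [mul_neg, neg_mul, mul_assoc]
    _ = -1 := by rw [γ_mul_self, γ_mul_self]; simp [ηsgn]

theorem expG21_zero : expG21 0 = 1 := by simp [expG21]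

/-- A covector, written in the raised-index basis, is a vector of the algebra. -/
theorem sum_smul_γup (p : Fin 4 → ℝ) :
    ∑ μ, p μ • γup μ = ι Qmink (fun μ => ηsgn μ * p μ) := by
  rw [pi_eq_sum_univ' (fun μ => ηsgn μ * p μ), map_sum]
  refine Finset.sum_congr rfl fun μ _ => ?_
  rw [γup, γ, smul_smul, mul_comm, map_smul]

theorem Qmink_raise (p : Fin 4 → ℝ) :
    Qmink (fun μ => ηsgn μ * p μ) = ∑ μ, ∑ ν, ηm μ ν * p μ * p ν := by
  simp [Qmink, ηsgn, ηm, QuadraticMap.weightedSumSquares_apply, Fin.sum_univ_four]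

theorem hasPDeriv_mul_expG21 (R : STA) (p : Fin 4 → ℝ) (μ : Fin 4) :
    HasPDeriv μ (fun x => R * expG21 (-∑ ν, p ν * x ν))
      (fun x => -p μ • (R * expG21 (-∑ ν, p ν * x ν) * γ21)) := by
  intro L x
  set s : ℝ := -∑ ν, p ν * x ν with hs
  have hline : ∀ t : ℝ,
      -∑ ν, p ν * (x + t • (Pi.single μ 1 : Fin 4 → ℝ)) ν = s + t * -p μ := by
    intro t
    simp [hs, mul_add, Finset.sum_add_distrib, Pi.single_apply]
    ring
  have hL : ∀ θ : ℝ, L (R * expG21 θ) = Real.cos θ * L R + Real.sin θ * L (R * γ21) := by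
    intro θ
    simp [expG21, mul_add, Algebra.algebraMap_eq_smul_one]
  have hL' : L (-p μ • (R * expG21 s * γ21))
      = -Real.sin (s + 0 * -p μ) * (1 * -p μ) * L R
        + Real.cos (s + 0 * -p μ) * (1 * -p μ) * L (R * γ21) := by
    have h : R * expG21 s * γ21 = Real.cos s • (R * γ21) - Real.sin s • R := by
      simp [expG21, mul_add, add_mul, Algebra.algebraMap_eq_smul_one, mul_assoc, γ21_mul_self,
        sub_eq_add_neg]
    rw [h]
    simp only [map_smul, map_sub, smul_eq_mul, zero_mul, add_zero]
    ring
  simp only [hline, hL]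
  have hθ : HasDerivAt (fun t : ℝ => s + t * -p μ) (1 * -p μ) 0 :=
    ((hasDerivAt_id (0 : ℝ)).mul_const _).const_add s
  rw [← hs, hL']
  exact (hθ.cos.mul_const _).add (hθ.sin.mul_const _)

/-- The Dirac–Hestenes equation for classical spinor fields implies the relativistic
Hamilton–Jacobi equation: if `ψ(x) = R e^{S(x)γ21}` (with `R` a constant rotor and
`S(x) = -Σ Π_μ x^μ`) satisfies `∂ψ γ21 - m ψ γ⁰ + e A ψ = 0`, then
`Σ (Π_μ + eA_μ)γ^μ = m R γ⁰ R̃` and `(Π + eA)² = m²`. -/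
theorem statement5 (m e : ℝ) (hm : 0 < m)
    (R : STA) (hRe : R ∈ evenOdd Qmink 0) (hRr : R * reverse R = 1)
    (Pi' A : Fin 4 → ℝ)
    (S : (Fin 4 → ℝ) → ℝ) (hS : S = fun x => -∑ μ, Pi' μ * x μ)
    (ψ : (Fin 4 → ℝ) → STA) (hψ : ψ = fun x => R * expG21 (S x))
    (hDH : ∀ ψ' : Fin 4 → (Fin 4 → ℝ) → STA, (∀ μ, HasPDeriv μ ψ (ψ' μ)) →
      ∀ x, ∑ μ, γup μ * ψ' μ x * γ21 - m • (ψ x * γ 0)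
        + e • ((∑ μ, A μ • γup μ) * ψ x) = 0) :
    (∑ μ, (Pi' μ + e * A μ) • γup μ) = m • (R * γ 0 * reverse R)
    ∧ ∑ μ, ∑ ν, ηm μ ν * (Pi' μ + e * A μ) * (Pi' ν + e * A ν) = m ^ 2 := by
  have hP : (∑ μ, (Pi' μ + e * A μ) • γup μ) * R = m • (R * γ 0) := by
    subst hS hψ
    have h := hDH _ (hasPDeriv_mul_expG21 R Pi') 0
    have hterm : ∀ μ, γup μ * (-Pi' μ • (R * 1 * γ21)) * γ21 = (Pi' μ • γup μ) * R := by
      intro μ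
      simp [mul_assoc, γ21_mul_self]
    simp only [Pi.zero_apply, mul_zero, Finset.sum_const_zero, neg_zero, expG21_zero, hterm] at h
    rw [mul_one, ← Finset.sum_mul] at h
    simp only [add_smul, Finset.sum_add_distrib, mul_smul, ← Finset.smul_sum, add_mul,
      smul_mul_assoc] at h ⊢
    rw [← sub_eq_zero, ← h]
    abel
  refine ⟨?_, ?_⟩
  · rw [← smul_mul_assoc, ← hP, mul_assoc, hRr, mul_one]
  · rw [← Qmink_raise fun μ => Pi' μ + e * A μ]
    rw [sum_smul_γup fun μ => Pi' μ + e * A μ] at hP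
    set v : Fin 4 → ℝ := fun μ => ηsgn μ * (Pi' μ + e * A μ)
    have hsq : ι Qmink v * ι Qmink v * R = m ^ 2 • R := by
      rw [mul_assoc, hP, mul_smul_comm, ← mul_assoc, hP, smul_mul_assoc, mul_assoc, γ_mul_self,
        smul_smul, sq]
      simp [ηsgn]
    have h := congrArg (· * reverse R) hsq
    simp only [mul_assoc _ R, hRr, mul_one, smul_mul_assoc, ι_sq_scalar,
      ← Algebra.algebraMap_eq_smul_one] at h
    have : Invertible (2 : ℝ) := invertibleOfNonzero two_ne_zero
    exact (algebraMap ℝ STA).injective h
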